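/- Let α > -1/2. There is a constant C > 0 (depending only on α) such that for every measurable function φ : (0,∞) → ℂ, every A > 0 with |φ(t)| ≤ A for almost every t > 0, and all x, y > 0 with 0 < x/2 < y < 2x and x ≠ y, one has |K_φ^{L_α}(x,y) - K_φ^H(x,y)| ≤ C · (A/x) · (1 + √(x/|y-x|)). -/

import Mathlib

open MeasureTheory Set

/-- The Hermite heat kernel `W_t^H(x,y)`. -/
noncomputable def WH (t x y : ℝ) : ℝ :=
  (1 / Real.sqrt Real.pi) * Real.sqrt (Real.exp (-t) / (1 - Real.exp (-2*t))) *
    Real.exp (-(((x - Real.exp (-t) * y)^2 + (y - Real.exp (-t) * x)^2) /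
      (2 * (1 - Real.exp (-2*t)))))

/-- The kernel `K_φ^H(x,y) = ∫_0^∞ φ(t) (-∂_t W_t^H(x,y)) dt`. -/
noncomputable def KH (φ : ℝ → ℂ) (x y : ℝ) : ℂ :=
  ∫ t in Set.Ioi (0:ℝ), φ t * ((-(deriv (fun s => WH s x y) t) : ℝ) : ℂ)

/-- The modified Bessel function of the first kind and order `α`. -/
noncomputable def besselI (α z : ℝ) : ℝ :=
  ∑' k : ℕ, (z/2) ^ (2*(k:ℝ) + α) / ((k.factorial : ℝ) * Real.Gamma ((k:ℝ) + α + 1))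

/-- The Laguerre heat kernel `W_t^{L_α}(x,y)`. -/
noncomputable def WLa (α t x y : ℝ) : ℝ :=
  Real.sqrt (2 * Real.exp (-t) / (1 - Real.exp (-2*t))) *
    Real.sqrt (2*x*y*Real.exp (-t) / (1 - Real.exp (-2*t))) *
    besselI α (2*x*y*Real.exp (-t) / (1 - Real.exp (-2*t))) *
    Real.exp (-((x^2 + y^2) * (1 + Real.exp (-2*t)) / (2 * (1 - Real.exp (-2*t)))))

/-- The kernel `K_φ^{L_α}(x,y) = ∫_0^∞ φ(t) (-∂_t W_t^{L_α}(x,y)) dt`. -/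
noncomputable def KLa (α : ℝ) (φ : ℝ → ℂ) (x y : ℝ) : ℂ :=
  ∫ t in Set.Ioi (0:ℝ), φ t * ((-(deriv (fun s => WLa α s x y) t) : ℝ) : ℂ)

/-- The entire function `w ↦ ∑ wᵏ / (k! Γ(k + a + 1))`, for which
`I_a(z) = (z/2)^a * besselSeries a ((z/2)^2)`. -/
noncomputable def besselSeries (a w : ℝ) : ℝ :=
  ∑' k : ℕ, w ^ k / ((k.factorial : ℝ) * Real.Gamma ((k : ℝ) + a + 1))

theorem exists_le_Gamma_nat_add {a : ℝ} (ha : -1 < a) :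
    ∃ m > (0 : ℝ), ∀ k : ℕ, m ≤ Real.Gamma ((k : ℝ) + a + 1) := by
  have h0 : 0 < Real.Gamma (a + 1) := Real.Gamma_pos_of_pos (by linarith)
  have h1 : 0 < Real.Gamma (1 + a + 1) := Real.Gamma_pos_of_pos (by linarith)
  refine ⟨min (Real.Gamma (a + 1)) (Real.Gamma (1 + a + 1)), lt_min h0 h1, fun k => ?_⟩
  rcases k with _ | k
  · simp
  · refine (min_le_right _ _).trans ?_
    induction k with
    | zero => simp
    | succ k ih =>
      refine ih.trans ?_
      have hk : (0 : ℝ) ≤ k := k.cast_nonneg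
      have hpos : 0 < ((k + 1 : ℕ) : ℝ) + a + 1 := by push_cast; linarith
      have hG := Real.Gamma_pos_of_pos hpos
      have : ((k + 1 + 1 : ℕ) : ℝ) + a + 1 = (((k + 1 : ℕ) : ℝ) + a + 1) + 1 := by
        push_cast; ring
      rw [this, Real.Gamma_add_one hpos.ne']
      refine le_mul_of_one_le_left hG.le ?_
      push_cast; linarith

theorem summable_besselSeries {a : ℝ} (ha : -1 < a) (w : ℝ) :
    Summable fun k : ℕ => w ^ k / ((k.factorial : ℝ) * Real.Gamma ((k : ℝ) + a + 1)) := by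
  obtain ⟨m, hm, hmk⟩ := exists_le_Gamma_nat_add ha
  refine Summable.of_norm_bounded
    (g := fun k : ℕ => |w| ^ k / (k.factorial : ℝ) * m⁻¹)
    ((Real.summable_pow_div_factorial |w|).mul_right _) fun k => ?_
  have hf : (0 : ℝ) < k.factorial := by positivity
  have hG := hm.trans_le (hmk k)
  rw [norm_div, norm_pow, Real.norm_eq_abs, Real.norm_of_nonneg (by positivity), ← div_eq_mul_inv,
    div_div]
  gcongr
  exact hmk k

theorem hasDerivAt_besselSeries {a : ℝ} (ha : -1 < a) (w : ℝ) :
    HasDerivAt (besselSeries a) (besselSeries (a + 1) w) w := by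
  obtain ⟨m, hm, hmk⟩ := exists_le_Gamma_nat_add ha
  set R := |w| + 1 with hR
  have hRpos : 0 < R := by positivity
  let g' : ℕ → ℝ → ℝ := fun k y =>
    (k * y ^ (k - 1)) / ((k.factorial : ℝ) * Real.Gamma ((k : ℝ) + a + 1))
  have hsucc : ∀ (k : ℕ) (y : ℝ), ((k + 1 : ℕ) * y ^ k) / (((k + 1).factorial : ℕ) : ℝ)
      = y ^ k / (k.factorial : ℝ) := fun k y => by
    have hf : (0 : ℝ) < k.factorial := by positivity
    rw [Nat.factorial_succ]; push_cast; field_simp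
  have hu : Summable fun k : ℕ => (k * R ^ (k - 1)) / (k.factorial : ℝ) * m⁻¹ := by
    refine Summable.mul_right _ ?_
    rw [← summable_nat_add_iff 1]
    refine (Real.summable_pow_div_factorial R).congr fun k => ?_
    exact (hsucc k R).symm
  have key := hasDerivAt_tsum_of_isPreconnected (𝕜 := ℝ) (F := ℝ) (t := Metric.ball 0 R)
    (g := fun (k : ℕ) (y : ℝ) =>
      y ^ k / ((k.factorial : ℝ) * Real.Gamma ((k : ℝ) + a + 1)))
    (g' := g') (y₀ := w) (y := w) hu Metric.isOpen_ball (convex_ball 0 R).isPreconnected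
    (fun k y _ => (hasDerivAt_pow k y).div_const _)
    (fun k y hy => by
      have hf : (0 : ℝ) < k.factorial := by positivity
      have hG := hm.trans_le (hmk k)
      have hy' : |y| ≤ R := by simpa using (Metric.mem_ball.1 hy).le
      simp only [g']
      rw [norm_div, norm_mul, norm_pow, Real.norm_eq_abs, Real.norm_eq_abs, Nat.abs_cast,
        Real.norm_of_nonneg (by positivity), ← div_eq_mul_inv, div_div]
      gcongr
      exact hmk k)
    (by simp [hR]) (summable_besselSeries ha w) (by simp [hR])
  have hsum : ∑' k : ℕ, g' k w = besselSeries (a + 1) w := by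
    have hs : Summable fun k => g' k w := by
      refine Summable.of_norm_bounded hu fun k => ?_
      have hf : (0 : ℝ) < k.factorial := by positivity
      have hG := hm.trans_le (hmk k)
      simp only [g']
      rw [norm_div, norm_mul, norm_pow, Real.norm_eq_abs, Real.norm_eq_abs, Nat.abs_cast,
        Real.norm_of_nonneg (by positivity), ← div_eq_mul_inv, div_div]
      gcongr
      · simp [hR]
      · exact hmk k
    rw [hs.tsum_eq_zero_add, besselSeries]
    simp only [g', Nat.cast_zero, zero_mul, zero_div, zero_add, Nat.add_sub_cancel]
    refine tsum_congr fun k => ?_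
    rw [← div_div, hsucc, div_div]
    congr 3
    push_cast; ring
  rw [hsum] at key
  exact key

theorem besselSeries_nonneg {a : ℝ} (ha : -1 < a) {w : ℝ} (hw : 0 ≤ w) : 0 ≤ besselSeries a w := by
  obtain ⟨m, hm, hmk⟩ := exists_le_Gamma_nat_add ha
  refine tsum_nonneg fun k => ?_
  have hG := hm.trans_le (hmk k)
  positivity

theorem besselSeries_le {a : ℝ} (ha : -1 < a) {w v : ℝ} (hw : 0 ≤ w) (hwv : w ≤ v) :
    besselSeries a w ≤ besselSeries a v := by
  obtain ⟨m, hm, hmk⟩ := exists_le_Gamma_nat_add ha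
  refine (summable_besselSeries ha w).tsum_le_tsum (fun k => ?_) (summable_besselSeries ha v)
  have hG := hm.trans_le (hmk k)
  gcongr

theorem besselI_eq {a z : ℝ} (hz : 0 < z) :
    besselI a z = (z / 2) ^ a * besselSeries a ((z / 2) ^ 2) := by
  rw [besselI, besselSeries, ← tsum_mul_left]
  refine tsum_congr fun k => ?_
  rw [Real.rpow_add (by positivity), ← pow_mul, mul_comm ((z / 2) ^ (2 * (k : ℝ))), mul_div_assoc]
  congr 2
  exact_mod_cast Real.rpow_natCast (z / 2) (2 * k)

theorem hasDerivAt_besselI {a z : ℝ} (ha : -1 < a) (hz : 0 < z) :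
    HasDerivAt (besselI a) (a / z * besselI a z + besselI (a + 1) z) z := by
  have h2 : HasDerivAt (fun y : ℝ => y / 2) (1 / 2) z := (hasDerivAt_id z).div_const 2
  have h := (h2.rpow_const (p := a) (Or.inl (by positivity))).mul
    ((hasDerivAt_besselSeries ha ((z / 2) ^ 2)).comp z (h2.pow 2))
  have he : besselI a =ᶠ[nhds z] fun y => (y / 2) ^ a * besselSeries a ((y / 2) ^ 2) := by
    filter_upwards [lt_mem_nhds hz] with y hy using besselI_eq hy
  refine (h.congr_of_eventuallyEq he).congr_deriv ?_
  rw [besselI_eq hz, besselI_eq hz, Real.rpow_sub_one (by positivity),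
    Real.rpow_add_one (by positivity)]
  simp only [Function.comp, Pi.pow_apply]
  field_simp
  ring

/-- The normalised Bessel function `√(2πz) e^{-z} I_a(z)`, which tends to `1` at infinity. -/
noncomputable def scaledBessel (a z : ℝ) : ℝ :=
  Real.sqrt (2 * Real.pi * z) * Real.exp (-z) * besselI a z

theorem hasDerivAt_scaledBessel {a z : ℝ} (ha : -1 < a) (hz : 0 < z) :
    HasDerivAt (scaledBessel a) ((a + 1 / 2) / z * scaledBessel a z - scaledBessel a z
      + scaledBessel (a + 1) z) z := by
  have hpi := Real.pi_pos
  have h1 : HasDerivAt (fun y : ℝ => Real.sqrt (2 * Real.pi * y))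
      (2 * Real.pi / (2 * Real.sqrt (2 * Real.pi * z))) z := by
    have := ((hasDerivAt_id z).const_mul (2 * Real.pi)).sqrt (by simp; positivity)
    simpa using this
  have h2 : HasDerivAt (fun y : ℝ => Real.exp (-y)) (-Real.exp (-z)) z := by
    simpa using (hasDerivAt_neg z).exp
  refine ((h1.mul h2).mul (hasDerivAt_besselI ha hz)).congr_deriv ?_
  have hs : Real.sqrt (2 * Real.pi * z) ^ 2 = 2 * Real.pi * z := Real.sq_sqrt (by positivity)
  have hs0 : 0 < Real.sqrt (2 * Real.pi * z) := Real.sqrt_pos.2 (by positivity)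
  have h3 : 2 * Real.pi / (2 * Real.sqrt (2 * Real.pi * z))
      = 1 / 2 / z * Real.sqrt (2 * Real.pi * z) := by
    field_simp
    rw [hs]
  rw [h3]
  simp only [scaledBessel, Pi.mul_apply]
  ring

theorem integrableOn_and_integral_beta {p q : ℝ} (hp : 0 < p) (hq : 0 < q) :
    IntegrableOn (fun s : ℝ => s ^ (p - 1) * (1 - s) ^ (q - 1)) (Ioo 0 1) ∧
      ∫ s in Ioo (0 : ℝ) 1, s ^ (p - 1) * (1 - s) ^ (q - 1)
        = Real.Gamma p * Real.Gamma q / Real.Gamma (p + q) := by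
  have hb := ProbabilityTheory.beta_pos hp hq
  have h1 := ProbabilityTheory.lintegral_betaPDF (α := p) (β := q)
  rw [ProbabilityTheory.lintegral_betaPDF_eq_one hp hq] at h1
  set f : ℝ → ℝ := fun x =>
    1 / ProbabilityTheory.beta p q * x ^ (p - 1) * (1 - x) ^ (q - 1) with hf
  have hmeas : AEStronglyMeasurable f (volume.restrict (Ioo 0 1)) := by
    refine Measurable.aestronglyMeasurable ?_
    fun_prop
  have hnn : 0 ≤ᵐ[volume.restrict (Ioo 0 1)] f := by
    filter_upwards [ae_restrict_mem measurableSet_Ioo] with x hx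
    have h0 : 0 < x := hx.1
    have h1 : 0 < 1 - x := sub_pos.2 hx.2
    simp only [hf, Pi.zero_apply]
    positivity
  have hint : Integrable f (volume.restrict (Ioo 0 1)) := by
    refine ⟨hmeas, ?_⟩
    rw [hasFiniteIntegral_iff_ofReal hnn, ← h1]
    exact ENNReal.one_lt_top
  have hval : ∫ x in Ioo (0 : ℝ) 1, f x = 1 := by
    rw [integral_eq_lintegral_of_nonneg_ae hnn hmeas, ← h1, ENNReal.toReal_one]
  have hfg : ∀ x, ProbabilityTheory.beta p q * f x = x ^ (p - 1) * (1 - x) ^ (q - 1) := by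
    intro x
    simp only [hf]
    field_simp
  refine ⟨(hint.const_mul (ProbabilityTheory.beta p q)).congr (.of_forall hfg), ?_⟩
  simp_rw [← hfg]
  rw [integral_const_mul, hval, mul_one, ProbabilityTheory.beta]

theorem integral_cosh_sqrt_eq_besselSeries {b : ℝ} (hb : -1 < b) (z : ℝ) :
    ∫ s in Ioo (0 : ℝ) 1, s ^ (-1 / 2 : ℝ) * (1 - s) ^ b * Real.cosh (z * Real.sqrt s)
      = Real.sqrt Real.pi * Real.Gamma (b + 1) * besselSeries (b + 1 / 2) ((z / 2) ^ 2) := by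
  let F : ℕ → ℝ → ℝ := fun k s =>
    s ^ (-1 / 2 : ℝ) * (1 - s) ^ b * ((z * Real.sqrt s) ^ (2 * k) / ((2 * k).factorial : ℝ))
  have hFeq : ∀ k, EqOn (F k) (fun s => z ^ (2 * k) / ((2 * k).factorial : ℝ) *
      (s ^ ((k : ℝ) + 1 / 2 - 1) * (1 - s) ^ (b + 1 - 1))) (Ioo 0 1) := by
    intro k s hs
    have hs0 : 0 < s := hs.1
    have h1 : Real.sqrt s ^ (2 * k) = s ^ (k : ℝ) := by
      rw [pow_mul, Real.sq_sqrt hs0.le, Real.rpow_natCast]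
    have h2 : s ^ ((k : ℝ) + 1 / 2 - 1) = s ^ (-1 / 2 : ℝ) * s ^ (k : ℝ) := by
      rw [← Real.rpow_add hs0]; congr 1; ring
    simp only [F]
    rw [mul_pow, h1, h2, add_sub_cancel_right]
    ring
  have hbeta : ∀ k : ℕ, _ := fun k =>
    integrableOn_and_integral_beta (p := (k : ℝ) + 1 / 2) (q := b + 1)
      (by positivity) (by linarith)
  have hFint : ∀ k, Integrable (F k) (volume.restrict (Ioo 0 1)) := fun k =>
    IntegrableOn.congr_fun ((hbeta k).1.const_mul _) (hFeq k).symm measurableSet_Ioo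
  have hFval : ∀ k, ∫ s in Ioo (0 : ℝ) 1, F k s = Real.sqrt Real.pi * Real.Gamma (b + 1) *
      (((z / 2) ^ 2) ^ k / ((k.factorial : ℝ) * Real.Gamma ((k : ℝ) + (b + 1 / 2) + 1))) := by
    intro k
    rw [setIntegral_congr_fun measurableSet_Ioo (hFeq k), integral_const_mul, (hbeta k).2]
    have hd := Real.Gamma_mul_Gamma_add_half ((k : ℝ) + 1 / 2)
    have e1 : (k : ℝ) + 1 / 2 + 1 / 2 = k + 1 := by ring
    have e2 : 2 * ((k : ℝ) + 1 / 2) = ((2 * k : ℕ) : ℝ) + 1 := by push_cast; ring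
    have e3 : (1 : ℝ) - (((2 * k : ℕ) : ℝ) + 1) = -((2 * k : ℕ) : ℝ) := by ring
    rw [e1, e2, e3, Real.Gamma_nat_eq_factorial, Real.Gamma_nat_eq_factorial,
      Real.rpow_neg zero_le_two, Real.rpow_natCast] at hd
    have e4 : (k : ℝ) + 1 / 2 + (b + 1) = k + (b + 1 / 2) + 1 := by ring
    rw [e4]
    have hG : 0 < Real.Gamma ((k : ℝ) + (b + 1 / 2) + 1) :=
      Real.Gamma_pos_of_pos (by have : (0 : ℝ) ≤ k := k.cast_nonneg
                                linarith)
    have hk : (0 : ℝ) < k.factorial := by positivity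
    have h2k : (0 : ℝ) < (2 * k).factorial := by positivity
    have hd' : Real.Gamma ((k : ℝ) + 1 / 2)
        = ((2 * k).factorial : ℝ) * (2 ^ (2 * k))⁻¹ * Real.sqrt Real.pi / k.factorial := by
      rw [eq_div_iff hk.ne', hd]
    rw [hd', ← pow_mul, div_pow]
    field_simp
  have hnorm : ∀ k, ∫ s in Ioo (0 : ℝ) 1, ‖F k s‖ = ∫ s in Ioo (0 : ℝ) 1, F k s := by
    intro k
    refine setIntegral_congr_fun measurableSet_Ioo fun s hs => ?_
    have h0 : 0 < s := hs.1
    have h1 : 0 < 1 - s := sub_pos.2 hs.2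
    refine Real.norm_of_nonneg ?_
    simp only [F]
    rw [pow_mul]
    positivity
  have key := hasSum_integral_of_summable_integral_norm hFint (by
    simp_rw [hnorm, hFval]
    exact (summable_besselSeries (by linarith) _).mul_left _)
  simp_rw [hFval] at key
  have h1 := key.tsum_eq
  rw [tsum_mul_left] at h1
  rw [besselSeries, h1]
  refine setIntegral_congr_fun measurableSet_Ioo fun s _ => ?_
  simp only [F]
  rw [tsum_mul_left, ← Real.cosh_eq_tsum]

theorem integral_cosh_eq_besselSeries {b : ℝ} (hb : -1 < b) (z : ℝ) :
    ∫ v in Ioo (0 : ℝ) 1, 2 * ((v * (2 - v)) ^ b * Real.cosh (z * (1 - v)))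
      = Real.sqrt Real.pi * Real.Gamma (b + 1) * besselSeries (b + 1 / 2) ((z / 2) ^ 2) := by
  have himg : (fun v : ℝ => (1 - v) ^ 2) '' Ioo 0 1 = Ioo 0 1 := by
    ext s
    constructor
    · rintro ⟨v, ⟨h0, h1⟩, rfl⟩
      constructor <;> simp only <;> nlinarith
    · rintro ⟨h0, h1⟩
      have hs0 : 0 < Real.sqrt s := Real.sqrt_pos.2 h0
      have hs1 : Real.sqrt s < 1 := by rw [Real.sqrt_lt' one_pos]; simpa using h1
      refine ⟨1 - Real.sqrt s, ⟨by linarith, by linarith⟩, ?_⟩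
      simp [Real.sq_sqrt h0.le]
  have hinj : InjOn (fun v : ℝ => (1 - v) ^ 2) (Ioo 0 1) := by
    intro v hv w hw h
    have := (sq_eq_sq₀ (sub_pos.2 hv.2).le (sub_pos.2 hw.2).le).1 h
    linarith
  have hder : ∀ v ∈ Ioo (0 : ℝ) 1,
      HasDerivWithinAt (fun v : ℝ => (1 - v) ^ 2) (-(2 * (1 - v))) (Ioo 0 1) v := by
    intro v _
    have := (((hasDerivAt_id v).const_sub 1).pow 2).hasDerivWithinAt (s := Ioo 0 1)
    refine this.congr_deriv ?_
    simp
  rw [← integral_cosh_sqrt_eq_besselSeries hb z]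
  conv_rhs => rw [← himg]
  rw [integral_image_eq_integral_abs_deriv_smul measurableSet_Ioo hder hinj]
  refine setIntegral_congr_fun measurableSet_Ioo fun v hv => ?_
  have h1 : 0 < 1 - v := sub_pos.2 hv.2
  have h2 : ((1 - v) ^ 2) ^ (-1 / 2 : ℝ) = (1 - v)⁻¹ := by
    rw [← Real.rpow_natCast, ← Real.rpow_mul h1.le, ← Real.rpow_neg_one]
    norm_num
  have h3 : 1 - (1 - v) ^ 2 = v * (2 - v) := by ring
  simp only [smul_eq_mul]
  rw [h2, h3, Real.sqrt_sq h1.le, abs_neg, abs_of_pos (by positivity)]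
  field_simp

theorem scaledBessel_eq_integral {b z : ℝ} (hb : -1 < b) (hz : 0 < z) :
    scaledBessel (b + 1 / 2) z = z ^ (b + 1) / Real.Gamma (b + 1) *
      ∫ v in Ioo (0 : ℝ) 1, v ^ b * (1 - v / 2) ^ b *
        (Real.exp (-(z * v)) + Real.exp (-(z * (2 - v)))) := by
  have hpi := Real.pi_pos
  have hG : 0 < Real.Gamma (b + 1) := Real.Gamma_pos_of_pos (by linarith)
  have hI : ∫ v in Ioo (0 : ℝ) 1, v ^ b * (1 - v / 2) ^ b *
        (Real.exp (-(z * v)) + Real.exp (-(z * (2 - v))))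
      = (Real.exp (-z) / 2 ^ b) *
        ∫ v in Ioo (0 : ℝ) 1, 2 * ((v * (2 - v)) ^ b * Real.cosh (z * (1 - v))) := by
    rw [← integral_const_mul]
    refine setIntegral_congr_fun measurableSet_Ioo fun v hv => ?_
    have h0 : 0 < v := hv.1
    have h1 : 0 < 1 - v / 2 := by linarith [hv.2]
    have e1 : v * (2 - v) = 2 * (v * (1 - v / 2)) := by ring
    have e2 : Real.exp (-(z * v)) = Real.exp (-z) * Real.exp (z * (1 - v)) := by
      rw [← Real.exp_add]; congr 1; ring
    have e3 : Real.exp (-(z * (2 - v))) = Real.exp (-z) * Real.exp (-(z * (1 - v))) := by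
      rw [← Real.exp_add]; congr 1; ring
    have h2 : (0 : ℝ) < 2 ^ b := by positivity
    rw [e1, Real.mul_rpow zero_le_two (by positivity), Real.mul_rpow h0.le h1.le, e2, e3,
      Real.cosh_eq]
    field_simp
  rw [hI, integral_cosh_eq_besselSeries hb, scaledBessel, besselI_eq hz]
  have h4 : Real.sqrt (2 * Real.pi * z)
      = Real.sqrt Real.pi * (2 ^ (1 / 2 : ℝ) * z ^ (1 / 2 : ℝ)) := by
    rw [show 2 * Real.pi * z = Real.pi * (2 * z) by ring, Real.sqrt_mul hpi.le,
      Real.sqrt_eq_rpow (2 * z), Real.mul_rpow zero_le_two hz.le]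
  have h5 : z ^ (b + 1) = z ^ (1 / 2 : ℝ) * z ^ (b + 1 / 2) := by
    rw [← Real.rpow_add hz]; congr 1; ring
  have h6 : (2 : ℝ) ^ (b + 1 / 2) = 2 ^ b * 2 ^ (1 / 2 : ℝ) := Real.rpow_add two_pos _ _
  have h2 : (0 : ℝ) < 2 ^ b := by positivity
  have h3 : (0 : ℝ) < 2 ^ (1 / 2 : ℝ) := by positivity
  rw [h4, h5, Real.div_rpow hz.le zero_le_two, h6]
  field_simp

theorem exists_abs_one_sub_half_rpow_sub_one_le (b : ℝ) :
    ∃ M ≥ (0 : ℝ), ∀ v ∈ Icc (0 : ℝ) 1, |(1 - v / 2) ^ b - 1| ≤ M * v := by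
  have hcont : ContinuousOn (fun v : ℝ => b * (1 - v / 2) ^ (b - 1) * (-1 / 2)) (Icc 0 1) := by
    refine (continuousOn_const.mul (ContinuousOn.rpow_const (by fun_prop) ?_)).mul
      continuousOn_const
    intro v hv
    left
    linarith [hv.2]
  obtain ⟨M, hM⟩ := isCompact_Icc.exists_bound_of_continuousOn hcont
  refine ⟨M, (norm_nonneg _).trans (hM 0 (by simp)), fun v hv => ?_⟩
  have hder : ∀ x ∈ Icc (0 : ℝ) 1, HasDerivWithinAt (fun v : ℝ => (1 - v / 2) ^ b)
      (b * (1 - x / 2) ^ (b - 1) * (-1 / 2)) (Icc 0 1) x := by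
    intro x hx
    have h1 : HasDerivAt (fun v : ℝ => 1 - v / 2) (-1 / 2) x := by
      have := ((hasDerivAt_id x).div_const 2).const_sub 1
      exact this.congr_deriv (by norm_num)
    exact ((h1.rpow_const (p := b) (Or.inl (by linarith [hx.2]))).congr_deriv
      (by ring)).hasDerivWithinAt
  have := (convex_Icc (0 : ℝ) 1).norm_image_sub_le_of_norm_hasDerivWithin_le hder hM
    (left_mem_Icc.2 zero_le_one) hv
  simpa [abs_of_nonneg hv.1] using this

theorem exists_abs_one_sub_half_rpow_sub_le (b : ℝ) :
    ∃ M ≥ (0 : ℝ), ∀ v ∈ Icc (0 : ℝ) 1, |(1 - v / 2) ^ b - (1 - b / 2 * v)| ≤ M * v ^ 2 := by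
  obtain ⟨M, hM0, hM⟩ := exists_abs_one_sub_half_rpow_sub_one_le (b - 1)
  refine ⟨|b| / 2 * M, by positivity, fun v hv => ?_⟩
  have hder : ∀ x ∈ Icc (0 : ℝ) v, HasDerivWithinAt
      (fun v : ℝ => (1 - v / 2) ^ b - (1 - b / 2 * v))
      (-(b / 2) * ((1 - x / 2) ^ (b - 1) - 1)) (Icc 0 v) x := by
    intro x hx
    have h1 : HasDerivAt (fun v : ℝ => 1 - v / 2) (-1 / 2) x := by
      have := ((hasDerivAt_id x).div_const 2).const_sub 1
      exact this.congr_deriv (by norm_num)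
    have h2 : HasDerivAt (fun v : ℝ => 1 - b / 2 * v) (-(b / 2)) x := by
      have := ((hasDerivAt_id x).const_mul (b / 2)).const_sub 1
      exact this.congr_deriv (by simp)
    refine (((h1.rpow_const (p := b) (Or.inl (by linarith [hx.2, hv.2]))).sub h2).congr_deriv
      ?_).hasDerivWithinAt
    ring
  have hbd : ∀ x ∈ Icc (0 : ℝ) v, ‖-(b / 2) * ((1 - x / 2) ^ (b - 1) - 1)‖ ≤ |b| / 2 * (M * v) := by
    intro x hx
    rw [norm_mul, norm_neg, Real.norm_eq_abs, Real.norm_eq_abs, abs_div, abs_two]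
    gcongr
    refine (hM x ⟨hx.1, hx.2.trans hv.2⟩).trans ?_
    gcongr
    exact hx.2
  have := (convex_Icc (0 : ℝ) v).norm_image_sub_le_of_norm_hasDerivWithin_le hder hbd
    (left_mem_Icc.2 hv.1) (right_mem_Icc.2 hv.1)
  simp only [zero_div, sub_zero, Real.one_rpow, mul_zero, sub_self, Real.norm_eq_abs,
    abs_of_nonneg hv.1] at this
  calc _ ≤ _ := this
    _ = _ := by ring

theorem integrableOn_and_integral_rpow_mul_exp_neg {c z : ℝ} (hc : -1 < c) (hz : 0 < z) :
    IntegrableOn (fun v : ℝ => v ^ c * Real.exp (-(z * v))) (Ioi 0) ∧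
      ∫ v in Ioi (0 : ℝ), v ^ c * Real.exp (-(z * v)) = Real.Gamma (c + 1) / z ^ (c + 1) := by
  constructor
  · have := integrableOn_rpow_mul_exp_neg_mul_rpow hc one_pos hz
    simpa using this
  · have := Real.integral_rpow_mul_exp_neg_mul_Ioi (a := c + 1) (by linarith) hz
    rw [add_sub_cancel_right] at this
    rw [this, one_div, Real.inv_rpow hz.le]
    ring

/-- The function multiplying `e^{-zv}` in the remainder of Watson's lemma for
`∫₀¹ v^b (1 - v/2)^b e^{-zv} dv` is `O(v^{b+2})` on the whole half-line. -/
theorem exists_abs_truncated_sub_le (b : ℝ) :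
    ∃ M ≥ (0 : ℝ), ∀ v > (0 : ℝ),
      |(Iio (1 : ℝ)).indicator (fun v => v ^ b * (1 - v / 2) ^ b) v - v ^ b * (1 - b / 2 * v)|
        ≤ M * v ^ (b + 2) := by
  obtain ⟨M, hM0, hM⟩ := exists_abs_one_sub_half_rpow_sub_le b
  refine ⟨M + (1 + |b|), by positivity, fun v hv => ?_⟩
  have e : v ^ (b + 2) = v ^ b * v ^ 2 := by
    rw [Real.rpow_add hv]; congr 1; exact_mod_cast Real.rpow_natCast v 2
  have hvb : 0 < v ^ b := by positivity
  rw [e]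
  rcases lt_or_ge v 1 with h1 | h1
  · rw [indicator_of_mem (show v ∈ Iio (1 : ℝ) from h1), ← mul_sub, abs_mul, abs_of_pos hvb]
    calc v ^ b * |(1 - v / 2) ^ b - (1 - b / 2 * v)| ≤ v ^ b * (M * v ^ 2) := by
          gcongr; exact hM v ⟨hv.le, h1.le⟩
      _ ≤ (M + (1 + |b|)) * (v ^ b * v ^ 2) := by
          have : 0 ≤ (1 + |b|) * (v ^ b * v ^ 2) := by positivity
          linarith
  · rw [indicator_of_notMem (by simpa using h1), zero_sub, abs_neg, abs_mul, abs_of_pos hvb]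
    have h2 : |1 - b / 2 * v| ≤ (1 + |b|) * v ^ 2 := by
      calc |1 - b / 2 * v| ≤ |1| + |b / 2 * v| := abs_sub _ _
        _ = 1 + |b| / 2 * v := by rw [abs_mul, abs_div, abs_one, abs_two, abs_of_pos hv]
        _ ≤ (1 + |b|) * v ^ 2 := by nlinarith [abs_nonneg b, mul_nonneg (abs_nonneg b) hv.le]
    calc v ^ b * |1 - b / 2 * v| ≤ v ^ b * ((1 + |b|) * v ^ 2) := by gcongr
      _ ≤ (M + (1 + |b|)) * (v ^ b * v ^ 2) := by
          have : 0 ≤ M * (v ^ b * v ^ 2) := by positivity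
          linarith

theorem exists_rpow_mul_exp_neg_le (c : ℝ) :
    ∃ K ≥ (0 : ℝ), ∀ z ≥ (1 : ℝ), z ^ c * Real.exp (-z) ≤ K := by
  refine ⟨(⌈c⌉₊.factorial : ℝ), by positivity, fun z hz => ?_⟩
  have h1 : z ^ c ≤ z ^ ⌈c⌉₊ := by
    rw [← Real.rpow_natCast]
    exact Real.rpow_le_rpow_of_exponent_le hz (Nat.le_ceil c)
  have h2 := Real.pow_div_factorial_le_exp z (by linarith) ⌈c⌉₊
  rw [div_le_iff₀ (by positivity)] at h2
  rw [Real.exp_neg, ← div_eq_mul_inv, div_le_iff₀ (Real.exp_pos z), mul_comm]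
  exact h1.trans h2

theorem exists_abs_scaledBessel_sub_le {b : ℝ} (hb : -1 < b) :
    ∃ K ≥ (0 : ℝ), ∀ z ≥ (1 : ℝ),
      |scaledBessel (b + 1 / 2) z - (1 - b * (b + 1) / 2 / z)| ≤ K / z ^ 2 := by
  obtain ⟨M, hM0, hM⟩ := exists_abs_truncated_sub_le b
  obtain ⟨N, hN0, hN⟩ := exists_abs_one_sub_half_rpow_sub_one_le b
  obtain ⟨L, hL0, hL⟩ := exists_rpow_mul_exp_neg_le (b + 3)
  have hG : 0 < Real.Gamma (b + 1) := Real.Gamma_pos_of_pos (by linarith)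
  have hG3 : 0 < Real.Gamma (b + 2 + 1) := Real.Gamma_pos_of_pos (by linarith)
  have hIvb : IntegrableOn (fun v : ℝ => v ^ b) (Ioo 0 1) := by
    simpa using (integrableOn_and_integral_beta (p := b + 1) (q := 1) (by linarith) one_pos).1
  set B := ∫ v in Ioo (0 : ℝ) 1, v ^ b with hB
  have hB0 : 0 ≤ B := setIntegral_nonneg measurableSet_Ioo fun v hv => Real.rpow_nonneg hv.1.le _
  have hrpow : ∀ v ∈ Ioo (0 : ℝ) 1, 0 ≤ (1 - v / 2) ^ b ∧ (1 - v / 2) ^ b ≤ N + 1 := by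
    intro v hv
    refine ⟨Real.rpow_nonneg (by linarith [hv.2]) _, ?_⟩
    have h1 := (abs_le.1 (hN v ⟨hv.1.le, hv.2.le⟩)).2
    have h2 : N * v ≤ N * 1 := by gcongr; exact hv.2.le
    linarith
  refine ⟨M * Real.Gamma (b + 2 + 1) / Real.Gamma (b + 1)
    + (N + 1) * B * L / Real.Gamma (b + 1), by positivity, fun z hz => ?_⟩
  have hz0 : 0 < z := by linarith
  let p : ℝ → ℝ := fun v => v ^ b * (1 - v / 2) ^ b * Real.exp (-(z * v))
  let q : ℝ → ℝ := fun v => v ^ b * (1 - v / 2) ^ b * Real.exp (-(z * (2 - v)))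
  have hdom : ∀ v ∈ Ioo (0 : ℝ) 1, ∀ E : ℝ, 0 ≤ E →
      ‖v ^ b * (1 - v / 2) ^ b * E‖ ≤ (N + 1) * v ^ b * E := by
    intro v hv E hE
    have h0 := Real.rpow_nonneg hv.1.le b
    obtain ⟨h1, h2⟩ := hrpow v hv
    rw [Real.norm_of_nonneg (by positivity)]
    have := mul_le_mul_of_nonneg_left h2 h0
    nlinarith
  have hpint : IntegrableOn p (Ioo 0 1) := by
    refine Integrable.mono' (hIvb.const_mul (N + 1)) ?_ ?_
    · refine Measurable.aestronglyMeasurable ?_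
      fun_prop
    · filter_upwards [ae_restrict_mem measurableSet_Ioo] with v hv
      have h0 := Real.rpow_nonneg hv.1.le b
      refine (hdom v hv _ (Real.exp_pos _).le).trans ?_
      refine mul_le_of_le_one_right (by positivity) (Real.exp_le_one_iff.2 ?_)
      have := hv.1
      have : 0 ≤ z * v := by positivity
      linarith
  have hqle : ∀ v ∈ Ioo (0 : ℝ) 1, ‖q v‖ ≤ (N + 1) * Real.exp (-z) * v ^ b := by
    intro v hv
    have h0 := Real.rpow_nonneg hv.1.le b
    refine (hdom v hv _ (Real.exp_pos _).le).trans ?_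
    have : Real.exp (-(z * (2 - v))) ≤ Real.exp (-z) := by
      refine Real.exp_le_exp.2 ?_
      nlinarith [hv.2]
    calc (N + 1) * v ^ b * Real.exp (-(z * (2 - v))) ≤ (N + 1) * v ^ b * Real.exp (-z) := by
          gcongr
      _ = _ := by ring
  have hqint : IntegrableOn q (Ioo 0 1) := by
    refine Integrable.mono' (hIvb.const_mul ((N + 1) * Real.exp (-z))) ?_ ?_
    · refine Measurable.aestronglyMeasurable ?_
      fun_prop
    · filter_upwards [ae_restrict_mem measurableSet_Ioo] with v hv using hqle v hv
  have hE2 : |∫ v in Ioo (0 : ℝ) 1, q v| ≤ (N + 1) * Real.exp (-z) * B := by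
    rw [hB, ← integral_const_mul, ← Real.norm_eq_abs]
    refine norm_integral_le_of_norm_le (hIvb.const_mul ((N + 1) * Real.exp (-z))) ?_
    filter_upwards [ae_restrict_mem measurableSet_Ioo] with v hv using hqle v hv
  obtain ⟨i0, v0⟩ := integrableOn_and_integral_rpow_mul_exp_neg (c := b) hb hz0
  obtain ⟨i1, v1⟩ := integrableOn_and_integral_rpow_mul_exp_neg (c := b + 1) (by linarith) hz0
  obtain ⟨i2, v2⟩ := integrableOn_and_integral_rpow_mul_exp_neg (c := b + 2) (by linarith) hz0
  have hpind : ∫ v in Ioo (0 : ℝ) 1, p v = ∫ v in Ioi (0 : ℝ), (Iio (1 : ℝ)).indicator p v := by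
    rw [setIntegral_indicator measurableSet_Iio, Ioi_inter_Iio]
  have hpindint : IntegrableOn ((Iio (1 : ℝ)).indicator p) (Ioi 0) := by
    rw [IntegrableOn, integrable_indicator_iff measurableSet_Iio, IntegrableOn,
      Measure.restrict_restrict measurableSet_Iio, Iio_inter_Ioi]
    exact hpint
  have hmain : ∫ v in Ioi (0 : ℝ), (v ^ b * Real.exp (-(z * v))
      - b / 2 * (v ^ (b + 1) * Real.exp (-(z * v))))
      = Real.Gamma (b + 1) / z ^ (b + 1) - b / 2 * (Real.Gamma (b + 1 + 1) / z ^ (b + 1 + 1)) := by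
    rw [integral_sub i0 (i1.const_mul _), integral_const_mul, v0, v1]
  have hmainint : IntegrableOn (fun v : ℝ => v ^ b * Real.exp (-(z * v))
      - b / 2 * (v ^ (b + 1) * Real.exp (-(z * v)))) (Ioi 0) := i0.sub (i1.const_mul _)
  have hE1 : |(∫ v in Ioo (0 : ℝ) 1, p v) - (Real.Gamma (b + 1) / z ^ (b + 1)
      - b / 2 * (Real.Gamma (b + 1 + 1) / z ^ (b + 1 + 1)))|
      ≤ M * (Real.Gamma (b + 2 + 1) / z ^ (b + 2 + 1)) := by
    rw [hpind, ← hmain, ← integral_sub hpindint hmainint, ← v2,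
      ← integral_const_mul, ← Real.norm_eq_abs]
    refine norm_integral_le_of_norm_le (i2.const_mul M) ?_
    filter_upwards [ae_restrict_mem measurableSet_Ioi] with v hv
    have hv0 : 0 < v := hv
    have hexp := Real.exp_pos (-(z * v))
    have e1 : (Iio (1 : ℝ)).indicator p v
        = (Iio (1 : ℝ)).indicator (fun v => v ^ b * (1 - v / 2) ^ b) v * Real.exp (-(z * v)) := by
      by_cases h : v ∈ Iio (1 : ℝ)
      · rw [indicator_of_mem h, indicator_of_mem h]
      · rw [indicator_of_notMem h, indicator_of_notMem h, zero_mul]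
    have e2 : (Iio (1 : ℝ)).indicator p v - (v ^ b * Real.exp (-(z * v))
        - b / 2 * (v ^ (b + 1) * Real.exp (-(z * v))))
        = ((Iio (1 : ℝ)).indicator (fun v => v ^ b * (1 - v / 2) ^ b) v
          - v ^ b * (1 - b / 2 * v)) * Real.exp (-(z * v)) := by
      rw [e1, Real.rpow_add_one hv0.ne']; ring
    rw [e2, norm_mul, Real.norm_eq_abs, Real.norm_of_nonneg hexp.le, ← mul_assoc]
    gcongr
    exact hM v hv0
  have hsplit : ∫ v in Ioo (0 : ℝ) 1, v ^ b * (1 - v / 2) ^ b *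
      (Real.exp (-(z * v)) + Real.exp (-(z * (2 - v))))
      = (∫ v in Ioo (0 : ℝ) 1, p v) + ∫ v in Ioo (0 : ℝ) 1, q v := by
    rw [← integral_add hpint hqint]
    refine integral_congr_ae (.of_forall fun v => ?_)
    simp only [p, q]; ring
  rw [scaledBessel_eq_integral hb hz0, hsplit]
  set P := ∫ v in Ioo (0 : ℝ) 1, p v
  set Q := ∫ v in Ioo (0 : ℝ) 1, q v
  have hzb : 0 < z ^ (b + 1) := by positivity
  have g1 : Real.Gamma (b + 1 + 1) = (b + 1) * Real.Gamma (b + 1) :=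
    Real.Gamma_add_one (by linarith)
  have g2 : z ^ (b + 1 + 1) = z ^ (b + 1) * z := Real.rpow_add_one hz0.ne' _
  have g3 : z ^ (b + 2 + 1) = z ^ (b + 1) * z ^ 2 := by
    rw [show b + 2 + 1 = b + 1 + 1 + 1 by ring, Real.rpow_add_one hz0.ne', g2]; ring
  have g4 : z ^ (b + 3) = z ^ (b + 1) * z ^ 2 := by
    rw [← g3]; congr 1; ring
  have hLz := hL z hz
  rw [g4] at hLz
  rw [g1, g2, g3] at hE1
  have e : z ^ (b + 1) / Real.Gamma (b + 1) * (P + Q) - (1 - b * (b + 1) / 2 / z)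
      = z ^ (b + 1) / Real.Gamma (b + 1) *
        ((P - (Real.Gamma (b + 1) / z ^ (b + 1)
          - b / 2 * ((b + 1) * Real.Gamma (b + 1) / (z ^ (b + 1) * z)))) + Q) := by
    field_simp
    ring
  rw [e, abs_mul, abs_of_pos (by positivity)]
  calc _ ≤ z ^ (b + 1) / Real.Gamma (b + 1) *
        (M * (Real.Gamma (b + 2 + 1) / (z ^ (b + 1) * z ^ 2)) + (N + 1) * Real.exp (-z) * B) := by
        gcongr
        exact (abs_add_le _ _).trans (add_le_add hE1 hE2)
    _ = (M * Real.Gamma (b + 2 + 1) / Real.Gamma (b + 1)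
        + (N + 1) * B * (z ^ (b + 1) * z ^ 2 * Real.exp (-z)) / Real.Gamma (b + 1)) / z ^ 2 := by
        field_simp
    _ ≤ _ := by gcongr

theorem exists_abs_scaledBessel_le {a : ℝ} (ha : -1 / 2 ≤ a) :
    ∃ S ≥ (0 : ℝ), ∀ z, 0 < z → z ≤ 1 → |scaledBessel a z| ≤ S := by
  have hpi := Real.pi_pos
  have hP1 := besselSeries_nonneg (a := a) (by linarith) zero_le_one
  refine ⟨Real.sqrt (4 * Real.pi) * besselSeries a 1, by positivity, fun z hz hz1 => ?_⟩
  have hP := besselSeries_nonneg (a := a) (by linarith) (sq_nonneg (z / 2))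
  have e : Real.sqrt (2 * Real.pi * z) * (z / 2) ^ a
      = Real.sqrt (4 * Real.pi) * (z / 2) ^ (a + 1 / 2) := by
    rw [show 2 * Real.pi * z = 4 * Real.pi * (z / 2) by ring, Real.sqrt_mul (by positivity),
      Real.sqrt_eq_rpow (z / 2), Real.rpow_add (by positivity)]
    ring
  rw [scaledBessel, besselI_eq hz, abs_of_nonneg (by positivity)]
  calc Real.sqrt (2 * Real.pi * z) * Real.exp (-z) * ((z / 2) ^ a * besselSeries a ((z / 2) ^ 2))
      = Real.sqrt (4 * Real.pi) * (z / 2) ^ (a + 1 / 2) * Real.exp (-z)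
        * besselSeries a ((z / 2) ^ 2) := by rw [← e]; ring
    _ ≤ Real.sqrt (4 * Real.pi) * 1 * 1 * besselSeries a 1 := by
      gcongr
      · exact Real.rpow_le_one (by positivity) (by linarith) (by linarith)
      · exact Real.exp_le_one_iff.2 (by linarith)
      · exact besselSeries_le (by linarith) (by positivity) (by nlinarith)
    _ = _ := by ring

theorem exists_scaledBessel_bounds {a : ℝ} (ha : -1 / 2 < a) :
    ∃ C > (0 : ℝ), ∀ z > (0 : ℝ), |scaledBessel a z - 1| ≤ C / (1 + z) ∧
      |z * ((a + 1 / 2) / z * scaledBessel a z - scaledBessel a z + scaledBessel (a + 1) z)|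
        ≤ C / (1 + z) := by
  obtain ⟨b, rfl⟩ : ∃ b, a = b + 1 / 2 := ⟨a - 1 / 2, by ring⟩
  have hb : -1 < b := by linarith
  obtain ⟨K, hK0, hK⟩ := exists_abs_scaledBessel_sub_le hb
  obtain ⟨K', hK0', hK'⟩ := exists_abs_scaledBessel_sub_le (b := b + 1) (by linarith)
  obtain ⟨S, hS0, hS⟩ := exists_abs_scaledBessel_le (a := b + 1 / 2) ha.le
  obtain ⟨S', hS0', hS'⟩ := exists_abs_scaledBessel_le (a := b + 1 + 1 / 2) (by linarith)
  rw [show b + 1 / 2 + 1 = b + 1 + 1 / 2 by ring]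
  set D := |b * (b + 1) / 2| with hD
  have hD0 : 0 ≤ D := abs_nonneg _
  have hb1 : 0 < b + 1 := by linarith
  have hb2 : 0 < b + 2 := by linarith
  refine ⟨2 * ((b + 2) * (D + K) + K + K') + 2 * ((b + 2) * S + S + S' + 1), by positivity,
    fun z hz => ?_⟩
  set g := scaledBessel (b + 1 / 2) z
  set g' := scaledBessel (b + 1 + 1 / 2) z
  have hder : z * ((b + 1 / 2 + 1 / 2) / z * g - g + g') = (b + 1) * g - z * g + z * g' := by
    field_simp; ring
  rw [hder, le_div_iff₀ (by positivity), le_div_iff₀ (by positivity)]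
  have hT1 : 0 ≤ (b + 2) * (D + K) + K + K' := by positivity
  have hT2 : 0 ≤ (b + 2) * S + S + S' + 1 := by positivity
  rcases le_total z 1 with h1 | h1
  · have hg : |g| ≤ S := hS z hz h1
    have hg' : |g'| ≤ S' := hS' z hz h1
    have hbS : 0 ≤ (b + 1) * S := by positivity
    constructor
    · have h2 : |g - 1| ≤ S + 1 := (abs_sub _ _).trans (by rw [abs_one]; linarith)
      have : |g - 1| * (1 + z) ≤ (S + 1) * 2 := by gcongr; linarith
      linarith
    · have h2 : |(b + 1) * g - z * g + z * g'| ≤ (b + 1) * S + S + S' := by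
        calc _ ≤ |(b + 1) * g| + |z * g| + |z * g'| :=
              (abs_add_le _ _).trans (add_le_add_left (abs_sub _ _) _)
          _ = (b + 1) * |g| + z * |g| + z * |g'| := by
              rw [abs_mul, abs_mul, abs_mul, abs_of_pos hb1, abs_of_pos hz]
          _ ≤ (b + 1) * S + 1 * S + 1 * S' := by gcongr
          _ = _ := by ring
      have : |(b + 1) * g - z * g + z * g'| * (1 + z) ≤ ((b + 1) * S + S + S') * 2 := by
        gcongr; linarith
      linarith
  · have k1 : |g - (1 - b * (b + 1) / 2 / z)| ≤ K / z ^ 2 := hK z h1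
    have k2 : |g' - (1 - (b + 1) * (b + 1 + 1) / 2 / z)| ≤ K' / z ^ 2 := hK' z h1
    have hz2 : z ≤ z ^ 2 := by nlinarith
    have hg : |g - 1| ≤ (D + K) / z := by
      have : g - 1 = (g - (1 - b * (b + 1) / 2 / z)) - b * (b + 1) / 2 / z := by ring
      rw [this]
      refine (abs_sub _ _).trans ?_
      rw [abs_div _ z, abs_of_pos hz, ← hD]
      have : K / z ^ 2 ≤ K / z := by gcongr
      rw [add_div]; linarith
    have hscale : ∀ X T : ℝ, 0 ≤ T → |X| ≤ T / z → |X| * (1 + z) ≤ 2 * T := by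
      intro X T hT hX
      calc |X| * (1 + z) ≤ T / z * (z + z) := by gcongr
        _ = 2 * T := by field_simp; ring
    have hbD : 0 ≤ (b + 1) * (D + K) := by positivity
    constructor
    · have := hscale _ (D + K) (by positivity) hg
      linarith
    · have e : (b + 1) * g - z * g + z * g' = (b + 1) * (g - 1)
          + z * ((g' - (1 - (b + 1) * (b + 1 + 1) / 2 / z)) - (g - (1 - b * (b + 1) / 2 / z))) := by
        field_simp; ring
      have h2 : |(b + 1) * g - z * g + z * g'| ≤ ((b + 1) * (D + K) + K + K') / z := by
        rw [e]
        refine (abs_add_le _ _).trans ?_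
        rw [abs_mul, abs_mul, abs_of_pos hb1, abs_of_pos hz]
        calc _ ≤ (b + 1) * ((D + K) / z) + z * (K' / z ^ 2 + K / z ^ 2) := by
              gcongr
              exact (abs_sub _ _).trans (add_le_add k2 k1)
          _ = _ := by field_simp; ring
      have := hscale _ _ (by positivity) h2
      linarith

theorem exp_neg_div_one_sub_exp {t : ℝ} (ht : 0 < t) :
    Real.exp (-t) / (1 - Real.exp (-2 * t)) = 1 / (2 * Real.sinh t) := by
  have h1 : Real.exp (-2 * t) = Real.exp (-t) * Real.exp (-t) := by
    rw [← Real.exp_add]; congr 1; ring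
  have h2 : Real.exp t * Real.exp (-t) = 1 := by rw [← Real.exp_add]; simp
  have h3 : Real.exp (-t) < 1 := Real.exp_lt_one_iff.2 (by linarith)
  have h4 := Real.exp_pos (-t)
  have hs : 0 < Real.sinh t := Real.sinh_pos_iff.2 ht
  have h5 : 0 < 1 - Real.exp (-2 * t) := by rw [h1]; nlinarith
  rw [div_eq_div_iff h5.ne' (by positivity), Real.sinh_eq, h1]
  linear_combination h2

theorem one_add_exp_div_one_sub_exp {t : ℝ} (ht : 0 < t) :
    (1 + Real.exp (-2 * t)) / (1 - Real.exp (-2 * t)) = Real.cosh t / Real.sinh t := by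
  have h1 : Real.exp (-2 * t) = Real.exp (-t) * Real.exp (-t) := by
    rw [← Real.exp_add]; congr 1; ring
  have h2 : Real.exp t * Real.exp (-t) = 1 := by rw [← Real.exp_add]; simp
  have h3 : Real.exp (-t) < 1 := Real.exp_lt_one_iff.2 (by linarith)
  have h4 := Real.exp_pos (-t)
  have hs : 0 < Real.sinh t := Real.sinh_pos_iff.2 ht
  have h5 : 0 < 1 - Real.exp (-2 * t) := by rw [h1]; nlinarith
  rw [div_eq_div_iff h5.ne' hs.ne', Real.sinh_eq, Real.cosh_eq, h1]
  linear_combination Real.exp (-t) * h2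

theorem WH_eq {t : ℝ} (ht : 0 < t) (x y : ℝ) :
    WH t x y = 1 / Real.sqrt Real.pi * Real.sqrt (1 / (2 * Real.sinh t)) *
      Real.exp (x * y / Real.sinh t - (x ^ 2 + y ^ 2) / 2 * (Real.cosh t / Real.sinh t)) := by
  have e1 := exp_neg_div_one_sub_exp ht
  have e2 := one_add_exp_div_one_sub_exp ht
  have h1 : Real.exp (-2 * t) = Real.exp (-t) * Real.exp (-t) := by
    rw [← Real.exp_add]; congr 1; ring
  rw [WH, e1, ← e2]
  congr 2
  have e3 : x * y / Real.sinh t = 2 * x * y * (Real.exp (-t) / (1 - Real.exp (-2 * t))) := by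
    rw [e1]; field_simp
  rw [e3]
  have : ∀ d : ℝ, -(((x - Real.exp (-t) * y) ^ 2 + (y - Real.exp (-t) * x) ^ 2) / (2 * d))
      = 2 * x * y * (Real.exp (-t) / d)
        - (x ^ 2 + y ^ 2) / 2 * ((1 + Real.exp (-2 * t)) / d) := by
    intro d
    rw [h1]
    ring
  exact this _

theorem WLa_eq {t x y : ℝ} (a : ℝ) (ht : 0 < t) (hx : 0 < x) (hy : 0 < y) :
    WLa a t x y = WH t x y * scaledBessel a (x * y / Real.sinh t) := by
  have hs : 0 < Real.sinh t := Real.sinh_pos_iff.2 ht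
  have hpi := Real.pi_pos
  have e1 := exp_neg_div_one_sub_exp ht
  have e2 := one_add_exp_div_one_sub_exp ht
  have e3 : 2 * x * y * Real.exp (-t) / (1 - Real.exp (-2 * t)) = x * y / Real.sinh t := by
    rw [mul_div_assoc, e1]; field_simp
  have e4 : 2 * Real.exp (-t) / (1 - Real.exp (-2 * t)) = 2 * (1 / (2 * Real.sinh t)) * 1 := by
    rw [mul_div_assoc, e1]; ring
  have e5 : (x ^ 2 + y ^ 2) * (1 + Real.exp (-2 * t)) / (2 * (1 - Real.exp (-2 * t)))
      = (x ^ 2 + y ^ 2) / 2 * (Real.cosh t / Real.sinh t) := by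
    rw [← e2, mul_div_mul_comm]
  have e6 : Real.sqrt (2 * Real.pi * (x * y / Real.sinh t))
      = Real.sqrt 2 * Real.sqrt Real.pi * Real.sqrt (x * y / Real.sinh t) := by
    rw [Real.sqrt_mul (by positivity), Real.sqrt_mul zero_le_two]
  rw [WLa, e3, e4, e5, WH_eq ht, scaledBessel, e6, sub_eq_add_neg, Real.exp_add, mul_one,
    Real.sqrt_mul zero_le_two]
  have h1 : Real.exp (x * y / Real.sinh t) * Real.exp (-(x * y / Real.sinh t)) = 1 := by
    rw [← Real.exp_add]; simp
  have h2 : 1 / Real.sqrt Real.pi * Real.sqrt Real.pi = 1 := by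
    have := Real.sqrt_pos.2 hpi
    field_simp
  have h3 : Real.exp (x * y / Real.sinh t) * Real.exp (-(x * y / Real.sinh t)) *
      (1 / Real.sqrt Real.pi * Real.sqrt Real.pi) = 1 := by rw [h1, h2, one_mul]
  clear h1 h2
  generalize Real.exp (x * y / Real.sinh t) = E at *
  generalize Real.exp (-(x * y / Real.sinh t)) = E' at *
  generalize 1 / Real.sqrt Real.pi = p at *
  linear_combination (-(Real.sqrt 2 * Real.sqrt (1 / (2 * Real.sinh t)) *
    Real.sqrt (x * y / Real.sinh t) * besselI a (x * y / Real.sinh t) *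
    Real.exp (-((x ^ 2 + y ^ 2) / 2 * (Real.cosh t / Real.sinh t))))) *
      h3

theorem hasDerivAt_cosh_div_sinh {t : ℝ} (ht : 0 < t) :
    HasDerivAt (fun s => Real.cosh s / Real.sinh s) (-(1 / Real.sinh t ^ 2)) t := by
  have hs : 0 < Real.sinh t := Real.sinh_pos_iff.2 ht
  refine ((Real.hasDerivAt_cosh t).div (Real.hasDerivAt_sinh t) hs.ne').congr_deriv ?_
  rw [← neg_div]
  congr 1
  linear_combination (Real.cosh_sq t) * (-1)

theorem hasDerivAt_const_div_sinh {t : ℝ} (ht : 0 < t) (k : ℝ) :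
    HasDerivAt (fun s => k / Real.sinh s) (-(k / Real.sinh t * (Real.cosh t / Real.sinh t))) t := by
  have hs : 0 < Real.sinh t := Real.sinh_pos_iff.2 ht
  refine ((hasDerivAt_const t k).div (Real.hasDerivAt_sinh t) hs.ne').congr_deriv ?_
  field_simp
  ring

theorem hasDerivAt_WH {t : ℝ} (ht : 0 < t) (x y : ℝ) :
    HasDerivAt (fun s => WH s x y) (WH t x y * (-(1 / 2) * (Real.cosh t / Real.sinh t)
      - x * y / Real.sinh t * (Real.cosh t / Real.sinh t)
      + (x ^ 2 + y ^ 2) / 2 * (1 / Real.sinh t ^ 2))) t := by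
  have hs : 0 < Real.sinh t := Real.sinh_pos_iff.2 ht
  have hq : 0 < 1 / (2 * Real.sinh t) := by positivity
  have h1 : HasDerivAt (fun s => 1 / (2 * Real.sinh s))
      (-(1 / (2 * Real.sinh t) * (Real.cosh t / Real.sinh t))) t := by
    have := hasDerivAt_const_div_sinh ht (1 / 2)
    refine (this.congr_deriv ?_).congr_of_eventuallyEq (.of_forall fun s => ?_)
    · rw [div_div]
    · simp only [div_div]
  have h2 : HasDerivAt (fun s => Real.sqrt (1 / (2 * Real.sinh s)))
      (-(1 / 2) * (Real.cosh t / Real.sinh t) * Real.sqrt (1 / (2 * Real.sinh t))) t := by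
    refine (h1.sqrt hq.ne').congr_deriv ?_
    have hsq := Real.sq_sqrt hq.le
    have hpos := Real.sqrt_pos.2 hq
    rw [div_eq_iff (by positivity)]
    linear_combination (Real.cosh t / Real.sinh t) * hsq
  have h3 := ((hasDerivAt_const_div_sinh ht (x * y)).sub
    ((hasDerivAt_cosh_div_sinh ht).const_mul ((x ^ 2 + y ^ 2) / 2))).exp
  have h4 := (h2.const_mul (1 / Real.sqrt Real.pi)).mul h3
  have he : (fun s => WH s x y) =ᶠ[nhds t] fun s =>
      1 / Real.sqrt Real.pi * Real.sqrt (1 / (2 * Real.sinh s)) *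
      Real.exp (x * y / Real.sinh s - (x ^ 2 + y ^ 2) / 2 * (Real.cosh s / Real.sinh s)) := by
    filter_upwards [lt_mem_nhds ht] with s hs using WH_eq hs x y
  refine (h4.congr_of_eventuallyEq he).congr_deriv ?_
  rw [WH_eq ht]
  simp only [Pi.sub_apply]
  ring

theorem WH_nonneg {t : ℝ} (ht : 0 < t) (x y : ℝ) : 0 ≤ WH t x y := by
  rw [WH_eq ht]; positivity

theorem WH_mul_coth_add_abs_deriv_le {t x y : ℝ} (ht : 0 < t) (hx : 0 < x) (hy : 0 < y) :
    WH t x y * (Real.cosh t / Real.sinh t) + |deriv (fun s => WH s x y) t|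
      ≤ 2 * (Real.cosh t / (Real.sqrt (Real.sinh t) * Real.sinh t)) *
        Real.exp (-((x - y) ^ 2 / 4 * (Real.cosh t / Real.sinh t))) := by
  have hW := WH_nonneg ht x y
  rw [(hasDerivAt_WH ht x y).deriv, abs_mul, abs_of_nonneg hW, ← mul_add, WH_eq ht]
  have hs : 0 < Real.sinh t := Real.sinh_pos_iff.2 ht
  have hc : 1 ≤ Real.cosh t := Real.one_le_cosh t
  have hpi : 0 < Real.sqrt Real.pi := Real.sqrt_pos.2 Real.pi_pos
  have hss : 0 < Real.sqrt (Real.sinh t) := Real.sqrt_pos.2 hs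
  set s := Real.sinh t
  set c := Real.cosh t
  have hc0 : 0 < c := by linarith
  set u := (x - y) ^ 2 / 4 * (c / s) with hu
  set w := x * y * (c - 1) / s with hw
  have hu0 : 0 ≤ u := by positivity
  have hw0 : 0 ≤ w := by
    have : 0 ≤ c - 1 := by linarith
    positivity
  have hexp : x * y / s - (x ^ 2 + y ^ 2) / 2 * (c / s) = -u + (-(u + w)) := by
    rw [hu, hw]; field_simp; ring
  have hr : 1 / Real.sqrt Real.pi * Real.sqrt (1 / (2 * s)) ≤ 1 / Real.sqrt s := by
    have h1 : 1 / Real.sqrt Real.pi ≤ 1 := by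
      rw [div_le_one hpi]
      exact Real.one_le_sqrt.2 (by linarith [Real.pi_gt_three])
    have h2 : Real.sqrt (1 / (2 * s)) ≤ 1 / Real.sqrt s := by
      rw [one_div, Real.sqrt_inv, ← one_div]
      gcongr
      linarith
    calc _ ≤ 1 * (1 / Real.sqrt s) := by gcongr
      _ = _ := one_mul _
  have hbr : |-(1 / 2) * (c / s) - x * y / s * (c / s) + (x ^ 2 + y ^ 2) / 2 * (1 / s ^ 2)|
      ≤ c / s * (1 / 2 + 2 * u + w) := by
    have e : -(1 / 2) * (c / s) - x * y / s * (c / s) + (x ^ 2 + y ^ 2) / 2 * (1 / s ^ 2)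
        = -(1 / 2) * (c / s) + 2 * u * (1 / (s * c)) - w * (1 / s) := by
      rw [hu, hw]; field_simp; ring
    have k1 : 1 / (s * c) ≤ c / s := by
      rw [div_le_div_iff₀ (by positivity) hs]
      nlinarith [mul_le_mul hc hc zero_le_one hc0.le]
    have k2 : 1 / s ≤ c / s := by gcongr
    have k3 : 0 < 1 / (s * c) := by positivity
    have k4 : 0 < 1 / s := by positivity
    have k5 : u * (1 / (s * c)) ≤ u * (c / s) := by gcongr
    have k6 : w * (1 / s) ≤ w * (c / s) := by gcongr
    have k7 : 0 ≤ u * (1 / (s * c)) := by positivity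
    have k8 : 0 ≤ w * (1 / s) := by positivity
    have k9 : 0 < c / s := by positivity
    rw [e, abs_le]
    constructor <;> nlinarith
  have hsum : 1 + (1 / 2 + 2 * u + w) ≤ 2 * Real.exp (u + w) := by
    rw [Real.exp_add]
    have h1 := Real.add_one_le_exp u
    have h2 := Real.add_one_le_exp w
    have h3 : (u + 1) * (w + 1) ≤ Real.exp u * Real.exp w := by gcongr
    nlinarith [mul_nonneg hu0 hw0]
  rw [hexp, Real.exp_add]
  calc _ ≤ 1 / Real.sqrt s * (Real.exp (-u) * Real.exp (-(u + w))) *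
        (c / s + c / s * (1 / 2 + 2 * u + w)) := by gcongr
    _ = 1 / Real.sqrt s * (Real.exp (-u) * Real.exp (-(u + w))) *
        (c / s * (1 + (1 / 2 + 2 * u + w))) := by ring
    _ ≤ 1 / Real.sqrt s * (Real.exp (-u) * Real.exp (-(u + w))) *
        (c / s * (2 * Real.exp (u + w))) := by gcongr
    _ = 2 * (c / (Real.sqrt s * s)) * Real.exp (-u) *
        (Real.exp (-(u + w)) * Real.exp (u + w)) := by field_simp
    _ = _ := by rw [← Real.exp_add]; simp

theorem integrableOn_and_integral_cosh_div {P : ℝ} (hP : 0 < P) :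
    IntegrableOn (fun t => Real.cosh t / (Real.sqrt (Real.sinh t) * (Real.sinh t + P))) (Ioi 0) ∧
      ∫ t in Ioi (0 : ℝ), Real.cosh t / (Real.sqrt (Real.sinh t) * (Real.sinh t + P))
        = Real.pi / Real.sqrt P := by
  have hsP : 0 < Real.sqrt P := Real.sqrt_pos.2 hP
  let G : ℝ → ℝ := fun t =>
    2 / Real.sqrt P * Real.arctan (Real.sqrt (Real.sinh t) / Real.sqrt P)
  have hcont : ContinuousWithinAt G (Ici 0) 0 := by
    refine Continuous.continuousWithinAt ?_
    have := Real.continuous_sinh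
    have := Real.continuous_arctan
    fun_prop
  have hder : ∀ t ∈ Ioi (0 : ℝ), HasDerivAt G
      (Real.cosh t / (Real.sqrt (Real.sinh t) * (Real.sinh t + P))) t := by
    intro t ht
    have hs : 0 < Real.sinh t := Real.sinh_pos_iff.2 ht
    have hss : 0 < Real.sqrt (Real.sinh t) := Real.sqrt_pos.2 hs
    have h := ((((Real.hasDerivAt_sinh t).sqrt hs.ne').div_const
      (Real.sqrt P)).arctan).const_mul (2 / Real.sqrt P)
    refine h.congr_deriv ?_
    rw [div_pow, Real.sq_sqrt hs.le, Real.sq_sqrt hP.le]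
    field_simp
    rw [Real.sq_sqrt hP.le]
    ring
  have hnn : ∀ t ∈ Ioi (0 : ℝ),
      0 ≤ Real.cosh t / (Real.sqrt (Real.sinh t) * (Real.sinh t + P)) := by
    intro t ht
    have hs : 0 < Real.sinh t := Real.sinh_pos_iff.2 ht
    have := Real.cosh_pos t
    positivity
  have hlim : Filter.Tendsto G Filter.atTop (nhds (2 / Real.sqrt P * (Real.pi / 2))) := by
    refine Filter.Tendsto.const_mul _ ?_
    have h1 : Filter.Tendsto Real.sinh Filter.atTop Filter.atTop :=
      Filter.tendsto_atTop_mono' _ (by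
        filter_upwards [Filter.eventually_ge_atTop 0] with t ht
        exact Real.self_le_sinh_iff.2 ht) Filter.tendsto_id
    have h2 := (Real.tendsto_sqrt_atTop.comp h1).atTop_div_const hsP
    exact (Real.tendsto_arctan_atTop.mono_right nhdsWithin_le_nhds).comp h2
  refine ⟨integrableOn_Ioi_deriv_of_nonneg hcont hder hnn hlim, ?_⟩
  rw [integral_Ioi_of_hasDerivAt_of_nonneg hcont hder hnn hlim]
  simp only [G, Real.sinh_zero, Real.sqrt_zero, zero_div, Real.arctan_zero, mul_zero, sub_zero]
  ring

theorem abs_deriv_WH_le {t x y : ℝ} (ht : 0 < t) (hx : 0 < x) (hy : 0 < y) (hxy : x ≠ y) :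
    |deriv (fun s => WH s x y) t|
      ≤ 2 * (Real.cosh t / (Real.sqrt (Real.sinh t) * (Real.sinh t + (x - y) ^ 2 / 4))) := by
  have hs : 0 < Real.sinh t := Real.sinh_pos_iff.2 ht
  have hss : 0 < Real.sqrt (Real.sinh t) := Real.sqrt_pos.2 hs
  have hc : 1 ≤ Real.cosh t := Real.one_le_cosh t
  have h := WH_mul_coth_add_abs_deriv_le ht hx hy
  have hd : 0 < (x - y) ^ 2 / 4 := by
    have := sub_ne_zero.2 hxy
    positivity
  have h0 : 0 ≤ WH t x y * (Real.cosh t / Real.sinh t) := by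
    have := WH_nonneg ht x y
    positivity
  set D := (x - y) ^ 2 / 4
  have he : Real.exp (-(D * (Real.cosh t / Real.sinh t)))
      ≤ Real.sinh t / (Real.sinh t + D) := by
    have h1 := Real.add_one_le_exp (D * (Real.cosh t / Real.sinh t))
    have h2 : D / Real.sinh t ≤ D * (Real.cosh t / Real.sinh t) := by
      rw [← mul_div_assoc]
      gcongr
      exact le_mul_of_one_le_right hd.le hc
    have h3 : (Real.sinh t + D) / Real.sinh t = D / Real.sinh t + 1 := by field_simp; ring
    rw [Real.exp_neg, ← inv_div (Real.sinh t + D)]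
    gcongr
    linarith
  calc _ ≤ 2 * (Real.cosh t / (Real.sqrt (Real.sinh t) * Real.sinh t)) *
        Real.exp (-(D * (Real.cosh t / Real.sinh t))) := by linarith
    _ ≤ 2 * (Real.cosh t / (Real.sqrt (Real.sinh t) * Real.sinh t)) *
        (Real.sinh t / (Real.sinh t + D)) := by gcongr
    _ = _ := by field_simp

theorem exists_abs_deriv_WLa_sub_le {a : ℝ} (ha : -1 / 2 < a) :
    ∃ C > (0 : ℝ), ∀ t x y : ℝ, 0 < t → 0 < x → 0 < y →
      |deriv (fun s => WLa a s x y) t - deriv (fun s => WH s x y) t|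
        ≤ C * (Real.cosh t / (Real.sqrt (Real.sinh t) * (Real.sinh t + x * y))) := by
  obtain ⟨C, hC, hb⟩ := exists_scaledBessel_bounds ha
  refine ⟨2 * C, by positivity, fun t x y ht hx hy => ?_⟩
  have hs : 0 < Real.sinh t := Real.sinh_pos_iff.2 ht
  have hss : 0 < Real.sqrt (Real.sinh t) := Real.sqrt_pos.2 hs
  have hc : 0 < Real.cosh t := Real.cosh_pos t
  have hz : 0 < x * y / Real.sinh t := by positivity
  have hW := WH_nonneg ht x y
  have hWd : HasDerivAt (fun s => WH s x y) (deriv (fun s => WH s x y) t) t :=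
    (hasDerivAt_WH ht x y).differentiableAt.hasDerivAt
  have hL := hWd.mul ((hasDerivAt_scaledBessel (a := a) (by linarith) hz).comp t
    (hasDerivAt_const_div_sinh ht (x * y)))
  have he : (fun s => WLa a s x y) =ᶠ[nhds t] fun s =>
      WH s x y * scaledBessel a (x * y / Real.sinh s) := by
    filter_upwards [lt_mem_nhds ht] with s hs using WLa_eq a hs hx hy
  rw [(hL.congr_of_eventuallyEq he).deriv]
  obtain ⟨b1, b2⟩ := hb _ hz
  have hk := WH_mul_coth_add_abs_deriv_le ht hx hy
  simp only [Function.comp]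
  set z := x * y / Real.sinh t with hzdef
  set g := scaledBessel a z
  set g' := (a + 1 / 2) / z * g - g + scaledBessel (a + 1) z
  set d := deriv (fun s => WH s x y) t
  set k := Real.cosh t / Real.sinh t
  have hk0 : 0 < k := by positivity
  have e : d * g + WH t x y * (g' * -(z * k)) - d = d * (g - 1) - WH t x y * k * (z * g') := by
    ring
  rw [e]
  have hexp : Real.exp (-((x - y) ^ 2 / 4 * k)) ≤ 1 :=
    Real.exp_le_one_iff.2 (neg_nonpos.2 (by positivity))
  have hk' : WH t x y * k + |d| ≤ 2 * (Real.cosh t / (Real.sqrt (Real.sinh t) * Real.sinh t)) :=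
    hk.trans (mul_le_of_le_one_right (by positivity) hexp)
  calc |d * (g - 1) - WH t x y * k * (z * g')|
      ≤ |d| * |g - 1| + WH t x y * k * |z * g'| := by
        refine (abs_sub _ _).trans ?_
        rw [abs_mul, abs_mul (WH t x y * k), abs_of_nonneg (by positivity : 0 ≤ WH t x y * k)]
    _ ≤ |d| * (C / (1 + z)) + WH t x y * k * (C / (1 + z)) := by gcongr
    _ = (WH t x y * k + |d|) * (C / (1 + z)) := by ring
    _ ≤ 2 * (Real.cosh t / (Real.sqrt (Real.sinh t) * Real.sinh t)) * (C / (1 + z)) := by gcongr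
    _ = _ := by rw [hzdef]; field_simp

theorem laguerre_hermite_kernel_difference_estimate (α : ℝ) (hα : -1/2 < α) :
    ∃ C > (0:ℝ), ∀ (φ : ℝ → ℂ) (A : ℝ), Measurable φ → 0 < A →
      (∀ᵐ t ∂(volume.restrict (Set.Ioi (0:ℝ))), ‖φ t‖ ≤ A) →
      ∀ x y : ℝ, 0 < x → x/2 < y → y < 2*x → x ≠ y →
        ‖KLa α φ x y - KH φ x y‖ ≤ C * (A / x) * (1 + Real.sqrt (x / |y - x|)) := by
  obtain ⟨C, hC, hb⟩ := exists_abs_deriv_WLa_sub_le hα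
  refine ⟨C * (2 * Real.pi), by positivity, fun φ A hφ hA hφA x y hx hxy hyx hne => ?_⟩
  have hy : 0 < y := by linarith
  have hd : 0 < (x - y) ^ 2 / 4 := by
    have := sub_ne_zero.2 hne
    positivity
  have hP : 0 < x * y := by positivity
  obtain ⟨iH, -⟩ := integrableOn_and_integral_cosh_div hd
  obtain ⟨iD, vD⟩ := integrableOn_and_integral_cosh_div hP
  let fH : ℝ → ℂ := fun t => φ t * ((-(deriv (fun s => WH s x y) t) : ℝ) : ℂ)
  let fL : ℝ → ℂ := fun t => φ t * ((-(deriv (fun s => WLa α s x y) t) : ℝ) : ℂ)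
  have mH : Measurable fH :=
    hφ.mul (Complex.measurable_ofReal.comp (measurable_deriv _).neg)
  have mL : Measurable fL :=
    hφ.mul (Complex.measurable_ofReal.comp (measurable_deriv _).neg)
  have bH : ∀ᵐ t ∂(volume.restrict (Ioi (0 : ℝ))), ‖fH t‖ ≤ A * (2 *
      (Real.cosh t / (Real.sqrt (Real.sinh t) * (Real.sinh t + (x - y) ^ 2 / 4)))) := by
    filter_upwards [hφA, ae_restrict_mem measurableSet_Ioi] with t h1 ht
    have h2 := abs_deriv_WH_le ht hx hy hne
    simp only [fH]
    rw [norm_mul, Complex.norm_real, norm_neg, Real.norm_eq_abs]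
    gcongr
  have bD : ∀ᵐ t ∂(volume.restrict (Ioi (0 : ℝ))), ‖fL t - fH t‖ ≤ A * (C *
      (Real.cosh t / (Real.sqrt (Real.sinh t) * (Real.sinh t + x * y)))) := by
    filter_upwards [hφA, ae_restrict_mem measurableSet_Ioi] with t h1 ht
    have h2 := hb t x y ht hx hy
    have e : fL t - fH t = φ t * ((-(deriv (fun s => WLa α s x y) t
        - deriv (fun s => WH s x y) t) : ℝ) : ℂ) := by
      simp only [fL, fH]; push_cast; ring
    rw [e, norm_mul, Complex.norm_real, norm_neg, Real.norm_eq_abs]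
    gcongr
  have intH : IntegrableOn fH (Ioi 0) :=
    Integrable.mono' ((iH.const_mul 2).const_mul A) mH.aestronglyMeasurable bH
  have intD : IntegrableOn (fun t => fL t - fH t) (Ioi 0) :=
    Integrable.mono' ((iD.const_mul C).const_mul A) (mL.sub mH).aestronglyMeasurable bD
  have intL : IntegrableOn fL (Ioi 0) :=
    (intD.add intH).congr (.of_forall fun t => by simp)
  have hK : KLa α φ x y - KH φ x y = ∫ t in Ioi (0 : ℝ), (fL t - fH t) :=
    (integral_sub intL intH).symm
  have hbound : ‖∫ t in Ioi (0 : ℝ), (fL t - fH t)‖ ≤ A * (C * (Real.pi / Real.sqrt (x * y))) := by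
    rw [← vD, ← integral_const_mul, ← integral_const_mul]
    exact norm_integral_le_of_norm_le ((iD.const_mul C).const_mul A) bD
  have hsq : x / 2 ≤ Real.sqrt (x * y) := Real.le_sqrt_of_sq_le (by nlinarith)
  have hpi := Real.pi_pos
  rw [hK]
  calc _ ≤ A * (C * (Real.pi / Real.sqrt (x * y))) := hbound
    _ ≤ A * (C * (Real.pi / (x / 2))) := by gcongr
    _ = C * (2 * Real.pi) * (A / x) := by field_simp
    _ ≤ _ := le_mul_of_one_le_right (by positivity)
        (le_add_of_nonneg_right (Real.sqrt_nonneg _))
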